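/- Let θ > 0 and γ ≥ 0. Then the two-parameter Indian Buffet Process weights V^{IBP,0,θ}(γ) form a (0,θ)-solution: Σ_{j=0}^{∞} V^{IBP,0,θ}_{1,j}(γ) = 1 and, for every n ∈ ℕ and k ∈ ℕ₀, V^{IBP,0,θ}_{n,k}(γ) = Σ_{j=0}^{∞} C(k+j, j) ((θ)_{n↑})^j (θ+n)^k V^{IBP,0,θ}_{n+1,k+j}(γ). -/

import Mathlib

open scoped BigOperators

/-- Rising factorial `(x)_{j↑} = x(x+1)⋯(x+j-1)`. -/
noncomputable def risingFac (x : ℝ) (j : ℕ) : ℝ :=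
  ∏ i ∈ Finset.range j, (x + i)

/-- Indian Buffet Process weights `V^{IBP,α,θ}_{n,k}(γ)`. -/
noncomputable def VIBP (α θ γ : ℝ) (n k : ℕ) : ℝ :=
  (1 / (Nat.factorial k : ℝ)) * (γ / risingFac (θ + 1) (n - 1)) ^ k *
    Real.exp (-(∑ i ∈ Finset.Icc 1 n,
      γ * risingFac (α + θ) (i - 1) / risingFac (1 + θ) (i - 1)))

theorem risingFac_succ (x : ℝ) (j : ℕ) : risingFac x (j + 1) = risingFac x j * (x + j) :=
  Finset.prod_range_succ _ _

theorem risingFac_pos {x : ℝ} (hx : 0 < x) (j : ℕ) : 0 < risingFac x j :=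
  Finset.prod_pos fun _ _ => by positivity

theorem hasSum_pow_div_factorial (x : ℝ) :
    HasSum (fun j : ℕ => x ^ j / (j.factorial : ℝ)) (Real.exp x) := by
  rw [Real.exp_eq_exp_ℝ]
  exact NormedSpace.expSeries_div_hasSum_exp x

theorem choose_div_factorial_add (k j : ℕ) :
    ((k + j).choose j : ℝ) / ((k + j).factorial : ℝ) =
      1 / ((k.factorial : ℝ) * (j.factorial : ℝ)) := by
  have h : ((k + j).choose j : ℝ) * k.factorial * j.factorial = (k + j).factorial := by
    exact_mod_cast Nat.add_choose_mul_factorial_mul_factorial k j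
  rw [div_eq_div_iff (by positivity) (by positivity), ← h]
  ring

/-- The two-parameter IBP weights form a `(0,θ)`-solution. -/
theorem stmt_8
    (θ γ : ℝ) (hθ : 0 < θ) (hγ : 0 ≤ γ) :
    HasSum (fun j => VIBP 0 θ γ 1 j) 1 ∧
    ∀ n : ℕ, 1 ≤ n → ∀ k : ℕ,
      HasSum
        (fun j : ℕ =>
          (Nat.choose (k + j) j : ℝ) * (risingFac θ n) ^ j *
            (θ + (n : ℝ)) ^ k * VIBP 0 θ γ (n + 1) (k + j))
        (VIBP 0 θ γ n k) := by
  constructor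
  · have h := (hasSum_pow_div_factorial γ).mul_right (Real.exp (-γ))
    rw [← Real.exp_add, add_neg_cancel, Real.exp_zero] at h
    refine h.congr_fun fun j => ?_
    simp [VIBP, risingFac]
    ring
  · intro n hn k
    obtain ⟨m, rfl⟩ := Nat.exists_eq_add_of_le' hn
    set y := γ / risingFac (θ + 1) (m + 1) with hy
    set s := ∑ i ∈ Finset.Icc 1 (m + 1),
      γ * risingFac (0 + θ) (i - 1) / risingFac (1 + θ) (i - 1) with hs
    have hbase : (θ + (m + 1 : ℕ)) * y = γ / risingFac (θ + 1) m := by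
      have hD := (risingFac_pos (by positivity : 0 < θ + 1) m).ne'
      have hm : θ + 1 + m ≠ 0 := by positivity
      rw [hy, risingFac_succ]
      push_cast
      field_simp
      ring
    have hV : VIBP 0 θ γ (m + 1) k =
        1 / (k.factorial : ℝ) * ((θ + (m + 1 : ℕ)) * y) ^ k * Real.exp (-s) := by
      rw [hbase]
      rfl
    have hexp : Real.exp (-s) =
        Real.exp (-(s + risingFac θ (m + 1) * y)) * Real.exp (risingFac θ (m + 1) * y) := by
      rw [← Real.exp_add]
      congr 1
      ring
    have hV' (l : ℕ) : VIBP 0 θ γ (m + 1 + 1) l =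
        1 / (l.factorial : ℝ) * y ^ l * Real.exp (-(s + risingFac θ (m + 1) * y)) := by
      rw [VIBP, Finset.sum_Icc_succ_top (by lia), ← hs, Nat.add_sub_cancel, ← hy, zero_add,
        add_comm 1 θ, mul_comm γ, mul_div_assoc, ← hy]
    rw [hV, hexp, mul_pow, ← mul_assoc]
    refine ((hasSum_pow_div_factorial (risingFac θ (m + 1) * y)).mul_left _).congr_fun
      fun j => ?_
    rw [hV']
    linear_combination risingFac θ (m + 1) ^ j * (θ + (m + 1 : ℕ)) ^ k * y ^ (k + j) *
      Real.exp (-(s + risingFac θ (m + 1) * y)) * choose_div_factorial_add k j
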